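/- For all n, m ≥ 1 and all u : W_{n+m} → ℝ, the graph energies satisfy G_n(M_{n,m}u) ≤ 36·G_{n+m}(u); equivalently, E_n(M_{n,m}u, M_{n,m}u) ≤ 36·(5/3)^m·E_{n+m}(u,u). -/

import Mathlib

open MeasureTheory Filter Set
open scoped ENNReal NNReal Classical

noncomputable section

namespace SG

/-- The three vertices `p₀ = (0,0)`, `p₁ = (1,0)`, `p₂ = (1/2, √3/2)` viewed in `ℂ`. -/
def p : Fin 3 → ℂ := ![0, 1, 1/2 + (Real.sqrt 3 / 2) * Complex.I]

/-- The three contraction maps `fᵢ x = (x + pᵢ)/2`. -/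
def f (i : Fin 3) (x : ℂ) : ℂ := (x + p i) / 2

/-- `K` is the Sierpinski gasket: the (unique) nonempty compact set with
`K = f₀(K) ∪ f₁(K) ∪ f₂(K)`. -/
def IsSG (K : Set ℂ) : Prop :=
  K.Nonempty ∧ IsCompact K ∧ K = f 0 '' K ∪ f 1 '' K ∪ f 2 '' K

/-- `α = log 3 / log 2`. -/
def alpha : ℝ := Real.log 3 / Real.log 2

/-- `β* = log 5 / log 2`. -/
def betastar : ℝ := Real.log 5 / Real.log 2

/-- The normalized `α`-dimensional Hausdorff measure restricted to `K`. -/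
def nu (K : Set ℂ) : Measure ℂ :=
  ((Measure.hausdorffMeasure alpha : Measure ℂ) K)⁻¹ •
    (Measure.hausdorffMeasure alpha : Measure ℂ).restrict K

/-- `f_w` for a finite word `w` over `{0,1,2}` (empty word gives the identity). -/
def fwl : List (Fin 3) → ℂ → ℂ
  | [] => id
  | i :: t => f i ∘ fwl t

/-- `f_w` for a word `w ∈ W_n = {0,1,2}ⁿ`. -/
def fw {n : ℕ} (w : Fin n → Fin 3) : ℂ → ℂ := fwl (List.ofFn w)

/-- The cell `K_w = f_w(K)`. -/
def Kw (K : Set ℂ) {n : ℕ} (w : Fin n → Fin 3) : Set ℂ := fw w '' K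

/-- Adjacency `w⁽¹⁾ ∼ₙ w⁽²⁾`: distinct words with intersecting cells. -/
def Adj (K : Set ℂ) {n : ℕ} (w1 w2 : Fin n → Fin 3) : Prop :=
  w1 ≠ w2 ∧ (Kw K w1 ∩ Kw K w2).Nonempty

/-- `Pₙu(w) = ∫_K u(f_w(x)) ν(dx)`. -/
def P (K : Set ℂ) {n : ℕ} (u : ℂ → ℝ) (w : Fin n → Fin 3) : ℝ :=
  ∫ x, u (fw w x) ∂(nu K)

/-- `Aₙ(u)`: sum over unordered adjacent pairs in `W_n` of `(Pₙu(w⁽¹⁾) − Pₙu(w⁽²⁾))²`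
(written as half the sum over ordered pairs). -/
def A (K : Set ℂ) (n : ℕ) (u : ℂ → ℝ) : ℝ :=
  (1/2) * ∑ w1 : Fin n → Fin 3, ∑ w2 : Fin n → Fin 3,
    if Adj K w1 w2 then (P K u w1 - P K u w2)^2 else 0

/-- The graph energy `Eₙ(u,u)` on `W_n` (half the sum over ordered adjacent pairs). -/
def En (K : Set ℂ) {n : ℕ} (u : (Fin n → Fin 3) → ℝ) : ℝ :=
  (1/2) * ∑ w1 : Fin n → Fin 3, ∑ w2 : Fin n → Fin 3,
    if Adj K w1 w2 then (u w1 - u w2)^2 else 0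

/-- The effective resistance `Rₙ(a,b)` between two words of `W_n`. -/
def Rn (K : Set ℂ) {n : ℕ} (a b : Fin n → Fin 3) : ℝ :=
  (sInf {e : ℝ | ∃ u : (Fin n → Fin 3) → ℝ, u a = 1 ∧ u b = 0 ∧ e = En K u})⁻¹

/-- `Gₙ(u) = (5/3)ⁿ Eₙ(u,u)`. -/
def G (K : Set ℂ) {n : ℕ} (u : (Fin n → Fin 3) → ℝ) : ℝ := (5/3)^n * En K u

/-- The mean value operator `M_{n,m}`: `(M_{n,m}u)(w) = 3^{−m} Σ_{v ∈ W_m} u(wv)`. -/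
def Mop (n m : ℕ) (u : (Fin (n + m) → Fin 3) → ℝ) : (Fin n → Fin 3) → ℝ :=
  fun w => (1/3)^m * ∑ v : Fin m → Fin 3, u (Fin.append w v)

/-! ### Barycentric coordinates and the geometry of cells -/

/-- The barycentric coordinates with respect to the triangle `p 0`, `p 1`, `p 2`. -/
def bary : Fin 3 → ℂ → ℝ :=
  ![fun z => 1 - z.re - z.im / Real.sqrt 3, fun z => z.re - z.im / Real.sqrt 3,
    fun z => 2 * z.im / Real.sqrt 3]

lemma bary_sum (z : ℂ) : bary 0 z + bary 1 z + bary 2 z = 1 := by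
  simp only [bary, Matrix.cons_val]
  ring

lemma bary_f (i j : Fin 3) (z : ℂ) :
    bary i (f j z) = (bary i z + if i = j then 1 else 0) / 2 := by
  have h3 : Real.sqrt 3 ≠ 0 := by positivity
  fin_cases i <;> fin_cases j <;> simp [bary, f, p] <;> field_simp <;> ring

lemma bary_p (i j : Fin 3) : bary i (p j) = if i = j then 1 else 0 := by
  have h3 : Real.sqrt 3 ≠ 0 := by positivity
  fin_cases i <;> fin_cases j <;> simp [bary, p] <;> field_simp <;> norm_num

lemma bary_ext {z z' : ℂ} (h : ∀ i, bary i z = bary i z') : z = z' := by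
  have h3 : Real.sqrt 3 ≠ 0 := by positivity
  have h1 := h 1
  have h2 := h 2
  simp only [bary, Matrix.cons_val] at h1 h2
  have him : z.im = z'.im := by field_simp at h2; linarith
  rw [him] at h1
  exact Complex.ext (by linarith) him

lemma continuous_bary (i : Fin 3) : Continuous (bary i) := by
  fin_cases i <;> simp [bary] <;> fun_prop

lemma f_injective (i : Fin 3) : Function.Injective (f i) := by
  intro x y h
  simpa [f] using h

lemma f_p (i : Fin 3) : f i (p i) = p i := by
  simp [f]

section Cells

variable {K : Set ℂ}

lemma IsSG.f_mem (hK : IsSG K) (i : Fin 3) {z : ℂ} (hz : z ∈ K) : f i z ∈ K := by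
  rw [hK.2.2]
  fin_cases i
  · exact .inl (.inl ⟨z, hz, rfl⟩)
  · exact .inl (.inr ⟨z, hz, rfl⟩)
  · exact .inr ⟨z, hz, rfl⟩

lemma IsSG.exists_preimage (hK : IsSG K) {z : ℂ} (hz : z ∈ K) : ∃ i, ∃ y ∈ K, f i y = z := by
  rw [hK.2.2] at hz
  rcases hz with (⟨y, hy, h⟩ | ⟨y, hy, h⟩) | ⟨y, hy, h⟩
  exacts [⟨0, y, hy, h⟩, ⟨1, y, hy, h⟩, ⟨2, y, hy, h⟩]

lemma IsSG.bary_nonneg (hK : IsSG K) (i : Fin 3) {z : ℂ} (hz : z ∈ K) : 0 ≤ bary i z := by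
  obtain ⟨x, hx, hmin⟩ := hK.2.1.exists_isMinOn hK.1 (continuous_bary i).continuousOn
  obtain ⟨j, y, hy, rfl⟩ := hK.exists_preimage hx
  have h1 : bary i (f j y) ≤ bary i y := hmin hy
  have h2 : bary i (f j y) ≤ bary i z := hmin hz
  rw [bary_f] at h1 h2
  split_ifs at h1 h2 <;> linarith

lemma IsSG.bary_le_one (hK : IsSG K) (i : Fin 3) {z : ℂ} (hz : z ∈ K) : bary i z ≤ 1 := by
  have h0 := hK.bary_nonneg 0 hz
  have h1 := hK.bary_nonneg 1 hz
  have h2 := hK.bary_nonneg 2 hz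
  have h := bary_sum z
  fin_cases i <;> simp <;> linarith

lemma IsSG.eq_p_of_one_le (hK : IsSG K) (i : Fin 3) {z : ℂ} (hz : z ∈ K) (h : 1 ≤ bary i z) :
    z = p i := by
  have h0 := hK.bary_nonneg 0 hz
  have h1 := hK.bary_nonneg 1 hz
  have h2 := hK.bary_nonneg 2 hz
  have hs := bary_sum z
  refine bary_ext fun j => ?_
  rw [bary_p]
  fin_cases i <;> fin_cases j <;> simp at h ⊢ <;> linarith

lemma IsSG.p_mem (hK : IsSG K) (i : Fin 3) : p i ∈ K := by
  obtain ⟨x, hx, hmax⟩ := hK.2.1.exists_isMaxOn hK.1 (continuous_bary i).continuousOn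
  have h : bary i (f i x) ≤ bary i x := hmax (hK.f_mem i hx)
  rw [bary_f, if_pos rfl] at h
  rwa [← hK.eq_p_of_one_le i hx (by linarith)]

/-- The integer translation part of `bary i ∘ fwl L`, scaled by `2 ^ L.length`. -/
def offset (i : Fin 3) : List (Fin 3) → ℤ
  | [] => 0
  | j :: t => offset i t + if i = j then 2 ^ t.length else 0

lemma bary_fwl (i : Fin 3) (L : List (Fin 3)) (z : ℂ) :
    bary i (fwl L z) * 2 ^ L.length = bary i z + offset i L := by
  induction L with
  | nil => simp [fwl, offset]
  | cons j t ih =>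
    simp only [fwl, Function.comp, bary_f, offset, List.length_cons, pow_succ]
    push_cast
    split_ifs <;> linarith

lemma offset_bounds (i : Fin 3) (L : List (Fin 3)) :
    0 ≤ offset i L ∧ offset i L < 2 ^ L.length := by
  induction L with
  | nil => simp [offset]
  | cons j t ih =>
    have : (0 : ℤ) < 2 ^ t.length := by positivity
    simp only [offset, List.length_cons, pow_succ]
    split_ifs <;> constructor <;> linarith

lemma offset_ext : ∀ {L L' : List (Fin 3)}, L.length = L'.length →
    (∀ i, offset i L = offset i L') → L = L'
  | [], [], _, _ => rfl
  | j :: t, j' :: t', hl, h => by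
    have hl' : t.length = t'.length := by simpa using hl
    have hj : j = j' := by
      by_contra hne
      have := h j
      have h1 := offset_bounds j t
      have h2 := offset_bounds j t'
      simp only [offset, if_true, if_neg hne, ← hl'] at this h2
      linarith
    subst hj
    rw [offset_ext hl' fun i => by simpa [offset, hl'] using h i]

variable {n m : ℕ}

lemma eq_of_fw_eq {w w' : Fin n → Fin 3} {z : ℂ} (h : fw w z = fw w' z) : w = w' := by
  refine List.ofFn_injective (offset_ext (by simp) fun i => ?_)
  have h1 := bary_fwl i (List.ofFn w) z
  have h2 := bary_fwl i (List.ofFn w') z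
  unfold fw at h
  rw [h] at h1
  simp only [List.length_ofFn] at h1 h2
  exact_mod_cast (add_left_cancel (h1.symm.trans h2) : (offset i _ : ℝ) = _)

lemma IsSG.exists_corners (hK : IsSG K) {w w' : Fin n → Fin 3} (h : Adj K w w') :
    ∃ i j, fw w (p i) = fw w' (p j) := by
  obtain ⟨hne, _, ⟨y, hy, rfl⟩, ⟨y', hy', heq⟩⟩ := h
  have key : ∀ i, bary i y - bary i y' =
      ((offset i (List.ofFn w') - offset i (List.ofFn w) : ℤ) : ℝ) := by
    intro i
    have h1 := bary_fwl i (List.ofFn w) y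
    have h2 := bary_fwl i (List.ofFn w') y'
    unfold fw at heq
    rw [heq] at h2
    simp only [List.length_ofFn] at h1 h2
    push_cast
    linarith
  have corner : ∀ i, (0 < offset i (List.ofFn w') - offset i (List.ofFn w) → y = p i) ∧
      (offset i (List.ofFn w') - offset i (List.ofFn w) < 0 → y' = p i) := by
    refine fun i => ⟨fun hi => hK.eq_p_of_one_le i hy ?_, fun hi => hK.eq_p_of_one_le i hy' ?_⟩
    · have : (1 : ℝ) ≤ ((offset i (List.ofFn w') - offset i (List.ofFn w) : ℤ) : ℝ) := by
        exact_mod_cast hi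
      linarith [key i, hK.bary_nonneg i hy']
    · have : ((offset i (List.ofFn w') - offset i (List.ofFn w) : ℤ) : ℝ) ≤ (-1 : ℤ) := by
        exact_mod_cast (by omega)
      rw [← key i, Int.cast_neg, Int.cast_one] at this
      linarith [hK.bary_nonneg i hy]
  have hsum : ∑ i, (offset i (List.ofFn w') - offset i (List.ofFn w)) = 0 := by
    have h : ((∑ i, (offset i (List.ofFn w') - offset i (List.ofFn w)) : ℤ) : ℝ) = 0 := by
      rw [Int.cast_sum]
      simp only [← key, Fin.sum_univ_three]
      linarith [bary_sum y, bary_sum y']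
    exact_mod_cast h
  have hnz : ∃ i ∈ Finset.univ, offset i (List.ofFn w') - offset i (List.ofFn w) ≠ 0 := by
    by_contra! hall
    exact hne (List.ofFn_injective (offset_ext (by simp) fun i => by
      linarith [hall i (Finset.mem_univ i)]))
  obtain ⟨i, -, hi⟩ := Finset.exists_pos_of_sum_zero_of_exists_nonzero _ hsum hnz
  obtain ⟨j, -, hj⟩ : ∃ j ∈ Finset.univ,
      0 < -(offset j (List.ofFn w') - offset j (List.ofFn w)) := by
    refine Finset.exists_pos_of_sum_zero_of_exists_nonzero _ ?_ ?_
    · rw [Finset.sum_neg_distrib, hsum, neg_zero]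
    · exact hnz.imp fun i h => ⟨h.1, neg_ne_zero.2 h.2⟩
  rw [(corner i).1 hi, (corner j).2 (by linarith)] at heq
  exact ⟨i, j, heq.symm⟩

lemma card_adj_le (hK : IsSG K) (w : Fin n → Fin 3) :
    (Finset.univ.filter fun w' => Adj K w w').card ≤ 6 := by
  choose! i j hij using fun w' (h : Adj K w w') => hK.exists_corners h
  calc _ ≤ (Finset.univ : Finset (Fin 3)).offDiag.card := by
        refine Finset.card_le_card_of_injOn (fun w' => (i w', j w')) ?_ ?_
        · intro w' hw'
          have hw' : Adj K w w' := by simpa using hw'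
          have h := hij w' hw'
          simp only [Finset.coe_offDiag, Finset.coe_univ, Set.mem_offDiag, Set.mem_univ, true_and]
          intro hc
          rw [hc] at h
          exact hw'.1 (eq_of_fw_eq h)
        · intro w₁ h₁ w₂ h₂ h
          have h₁ : Adj K w w₁ := by simpa using h₁
          have h₂ : Adj K w w₂ := by simpa using h₂
          obtain ⟨hi, hj⟩ := Prod.mk.inj h
          have e₁ := hij w₁ h₁
          rw [hi, hj, hij w₂ h₂] at e₁
          exact (eq_of_fw_eq e₁).symm
    _ = 6 := by decide

lemma fwl_append (L L' : List (Fin 3)) (z : ℂ) : fwl (L ++ L') z = fwl L (fwl L' z) := by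
  induction L with
  | nil => rfl
  | cons i t ih => simp [fwl, ih]

lemma fwl_injective (L : List (Fin 3)) : Function.Injective (fwl L) := by
  induction L with
  | nil => exact Function.injective_id
  | cons i t ih => exact (f_injective i).comp ih

lemma fw_append (w : Fin n → Fin 3) (v : Fin m → Fin 3) (z : ℂ) :
    fw (Fin.append w v) z = fw w (fw v z) := by
  simp [fw, List.ofFn_fin_append, fwl_append]

lemma fw_cons (i : Fin 3) (v : Fin m → Fin 3) (z : ℂ) :
    fw (Fin.cons i v : Fin (m + 1) → Fin 3) z = f i (fw v z) := by
  simp [fw, fwl]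

lemma fw_const (i : Fin 3) : fw (fun _ : Fin m => i) (p i) = p i := by
  unfold fw
  rw [List.ofFn_const]
  induction m with
  | zero => rfl
  | succ m ih => simp [List.replicate_succ, fwl, ih, f_p]

lemma adj_append {v v' : Fin m → Fin 3} (w : Fin n → Fin 3) (h : Adj K v v') :
    Adj K (Fin.append w v) (Fin.append w v') := by
  obtain ⟨hne, _, ⟨y, hy, rfl⟩, ⟨y', hy', heq⟩⟩ := h
  refine ⟨fun hc => hne ?_, fw w (fw v y), ⟨y, hy, fw_append ..⟩, ⟨y', hy', ?_⟩⟩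
  · exact (Prod.mk.inj ((Fin.appendEquiv n m).injective (a₁ := (w, v)) (a₂ := (w, v')) hc)).2
  · rw [fw_append, heq]

lemma adj_cons {v v' : Fin m → Fin 3} (i : Fin 3) (h : Adj K v v') :
    Adj K (Fin.cons i v : Fin (m + 1) → Fin 3) (Fin.cons i v' : Fin (m + 1) → Fin 3) := by
  obtain ⟨hne, _, ⟨y, hy, rfl⟩, ⟨y', hy', heq⟩⟩ := h
  refine ⟨fun hc => hne (Fin.cons_right_injective (α := fun _ => Fin 3) i hc), f i (fw v y),
    ⟨y, hy, fw_cons ..⟩, ⟨y', hy', ?_⟩⟩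
  rw [fw_cons, heq]

lemma IsSG.adj_append_corner (hK : IsSG K) {w w' : Fin n → Fin 3} (hne : w ≠ w') {i j : Fin 3}
    (h : fw w (p i) = fw w' (p j)) :
    Adj K (Fin.append w fun _ : Fin m => i) (Fin.append w' fun _ : Fin m => j) := by
  refine ⟨fun hc => hne ?_, fw w (p i), ⟨p i, hK.p_mem i, ?_⟩, ⟨p j, hK.p_mem j, ?_⟩⟩
  · exact (Prod.mk.inj ((Fin.appendEquiv n m).injective
      (a₁ := (w, fun _ => i)) (a₂ := (w', fun _ => j)) hc)).1
  · rw [fw_append, fw_const]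
  · rw [fw_append, fw_const, h]

lemma IsSG.adj_cons_corner (hK : IsSG K) {i j : Fin 3} (hne : i ≠ j) :
    Adj K (Fin.cons i fun _ => j : Fin (m + 1) → Fin 3)
      (Fin.cons j fun _ => i : Fin (m + 1) → Fin 3) := by
  refine ⟨fun hc => hne (by simpa using congrFun hc 0), f i (p j),
    ⟨p j, hK.p_mem j, ?_⟩, ⟨p i, hK.p_mem i, ?_⟩⟩
  · rw [fw_cons, fw_const]
  · rw [fw_cons, fw_const, f, f, add_comm]

end Cells

/-! ### Energies of graphs divided into blocks -/

/-- The energy of `u` on the graph with adjacency relation `r`. -/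
def energy {V : Type*} [Fintype V] (r : V → V → Prop) (u : V → ℝ) : ℝ :=
  (1 / 2) * ∑ a, ∑ b, if r a b then (u a - u b) ^ 2 else 0

lemma energy_nonneg {V : Type*} [Fintype V] (r : V → V → Prop) (u : V → ℝ) : 0 ≤ energy r u := by
  refine mul_nonneg (by norm_num) (Finset.sum_nonneg fun a _ => Finset.sum_nonneg fun b _ => ?_)
  split_ifs <;> positivity

lemma En_eq_energy (K : Set ℂ) {n : ℕ} (u : (Fin n → Fin 3) → ℝ) : En K u = energy (Adj K) u :=
  rfl

lemma En_nonneg (K : Set ℂ) {n : ℕ} (u : (Fin n → Fin 3) → ℝ) : 0 ≤ En K u :=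
  energy_nonneg _ _

/-- If a graph is divided into blocks `e (i, ·)`, its energy is at least the sum of the energies of
the blocks and of the contributions of one edge for each pair of related blocks. -/
lemma energy_split {I V X : Type*} [Fintype I] [Fintype V] [Fintype X] (e : I × V ≃ X)
    {R : I → I → Prop} {r : V → V → Prop} {s : X → X → Prop} (c c' : I → I → V)
    (hR : ∀ i j, R i j → i ≠ j) (hr : ∀ i v v', r v v' → s (e (i, v)) (e (i, v')))
    (hs : ∀ i j, R i j → s (e (i, c i j)) (e (j, c' i j))) (u : X → ℝ) :
    ∑ i, energy r (fun v => u (e (i, v))) +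
      (1 / 2) * ∑ i, ∑ j, (if R i j then (u (e (i, c i j)) - u (e (j, c' i j))) ^ 2 else 0)
      ≤ energy s u := by
  set t : I → V → I → V → ℝ := fun i v j v' =>
    if s (e (i, v)) (e (j, v')) then (u (e (i, v)) - u (e (j, v'))) ^ 2 else 0 with ht
  have ht0 : ∀ i v j v', 0 ≤ t i v j v' := by
    intro i v j v'
    simp only [ht]
    split_ifs <;> positivity
  have hE : energy s u = (1 / 2) * ∑ i, ∑ j, ∑ v, ∑ v', t i v j v' := by
    unfold energy
    rw [← e.sum_comp, Fintype.sum_prod_type]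
    congr 1
    refine Finset.sum_congr rfl fun i _ => ?_
    rw [Finset.sum_comm (s := Finset.univ (α := I))]
    refine Finset.sum_congr rfl fun v _ => ?_
    rw [← e.sum_comp, Fintype.sum_prod_type]
  have hblock : ∀ i j, (if i = j then 2 * energy r (fun v => u (e (i, v))) else 0) +
      (if R i j then (u (e (i, c i j)) - u (e (j, c' i j))) ^ 2 else 0)
      ≤ ∑ v, ∑ v', t i v j v' := by
    intro i j
    by_cases hij : i = j
    · subst hij
      have hn : ¬ R i i := fun h => hR i i h rfl
      rw [if_pos rfl, if_neg hn, add_zero, energy, ← mul_assoc, mul_one_div_cancel two_ne_zero,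
        one_mul]
      refine Finset.sum_le_sum fun v _ => Finset.sum_le_sum fun v' _ => ?_
      by_cases h : r v v'
      · simp [ht, h, hr i v v' h]
      · simpa [h] using ht0 i v i v'
    · rw [if_neg hij, zero_add]
      split_ifs with h
      · calc _ = t i (c i j) j (c' i j) := by simp [ht, hs i j h]
          _ ≤ ∑ v', t i (c i j) j v' :=
            Finset.single_le_sum (fun v' _ => ht0 i (c i j) j v') (Finset.mem_univ _)
          _ ≤ _ := Finset.single_le_sum (f := fun v => ∑ v', t i v j v')
            (fun v _ => Finset.sum_nonneg fun v' _ => ht0 i v j v') (Finset.mem_univ _)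
      · exact Finset.sum_nonneg fun v _ => Finset.sum_nonneg fun v' _ => ht0 i v j v'
  have := Finset.sum_le_sum fun i (_ : i ∈ Finset.univ) =>
    Finset.sum_le_sum fun j (_ : j ∈ Finset.univ) => hblock i j
  simp only [Finset.sum_add_distrib, Finset.sum_ite_eq, Finset.mem_univ, if_true,
    ← Finset.mul_sum] at this
  rw [hE]
  linarith

/-! ### Estimates inside one cell -/

section Estimates

variable {K : Set ℂ} {m : ℕ}

lemma IsSG.energy_cons (hK : IsSG K) (u : (Fin (m + 1) → Fin 3) → ℝ) :
    (En K (fun v => u (Fin.cons 0 v)) + En K (fun v => u (Fin.cons 1 v)) +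
      En K (fun v => u (Fin.cons 2 v))) +
      ((u (Fin.cons 0 fun _ => 1) - u (Fin.cons 1 fun _ => 0)) ^ 2 +
       (u (Fin.cons 0 fun _ => 2) - u (Fin.cons 2 fun _ => 0)) ^ 2 +
       (u (Fin.cons 1 fun _ => 2) - u (Fin.cons 2 fun _ => 1)) ^ 2) ≤ En K u := by
  have h := energy_split (Fin.consEquiv (n := m) fun _ => Fin 3) (R := (· ≠ ·)) (r := Adj K)
    (s := Adj K) (fun _ j _ => j) (fun i _ _ => i) (fun _ _ h => h) (fun i _ _ h => adj_cons i h)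
    (fun i j h => hK.adj_cons_corner h) u
  simp [Fin.sum_univ_three, Fin.consEquiv] at h
  simp only [En_eq_energy]
  refine le_trans (le_of_eq ?_) h
  ring

lemma IsSG.energy_cons_le (hK : IsSG K) (u : (Fin (m + 1) → Fin 3) → ℝ) (i : Fin 3) :
    En K (fun v => u (Fin.cons i v)) ≤ En K u := by
  have h := hK.energy_cons u
  have h' := fun i => En_nonneg K (fun v : Fin m → Fin 3 => u (Fin.cons i v))
  have := h' 0
  have := h' 1
  have := h' 2
  fin_cases i <;> simp only [Fin.zero_eta, Fin.mk_one, Fin.reduceFinMk] <;> nlinarith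

lemma IsSG.energy_cons_pair_le (hK : IsSG K) (u : (Fin (m + 1) → Fin 3) → ℝ) {i j : Fin 3}
    (hij : i ≠ j) :
    En K (fun v => u (Fin.cons i v)) + (u (Fin.cons i fun _ => j) - u (Fin.cons j fun _ => i)) ^ 2 +
      En K (fun v => u (Fin.cons j v)) ≤ En K u := by
  have h := hK.energy_cons u
  have h' := fun i => En_nonneg K (fun v : Fin m → Fin 3 => u (Fin.cons i v))
  have h0 := h' 0
  have h1 := h' 1
  have h2 := h' 2
  have s1 := sq_nonneg (u (Fin.cons 0 fun _ => 1) - u (Fin.cons 1 fun _ => 0))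
  have s2 := sq_nonneg (u (Fin.cons 0 fun _ => 2) - u (Fin.cons 2 fun _ => 0))
  have s3 := sq_nonneg (u (Fin.cons 1 fun _ => 2) - u (Fin.cons 2 fun _ => 1))
  fin_cases i <;> fin_cases j <;> simp only [Fin.zero_eta, Fin.mk_one, Fin.reduceFinMk] at hij ⊢ <;>
    first | exact absurd rfl hij | linarith

/-- The sum of the squared differences of the three corner values. -/
def spread (x : Fin 3 → ℝ) : ℝ := (x 0 - x 1) ^ 2 + (x 0 - x 2) ^ 2 + (x 1 - x 2) ^ 2

lemma sq_linear_le_spread (x : Fin 3 → ℝ) {a b c : ℝ} (h : a + b + c = 0) :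
    (a * x 0 + b * x 1 + c * x 2) ^ 2 ≤ (a ^ 2 + b ^ 2 + c ^ 2) / 3 * spread x := by
  obtain rfl : c = -a - b := by linarith
  unfold spread
  nlinarith [sq_nonneg ((x 0 - x 2) * (a + 2 * b) - (x 1 - x 2) * (2 * a + b))]

/-- Three triangles joined by unit resistors, in the form of a triangle-star transformation. -/
lemma spread_diag_le (x : Fin 3 → Fin 3 → ℝ) (E : Fin 3 → ℝ) {s : ℝ} (hs : 0 ≤ s)
    (hE : ∀ i, 0 ≤ E i) (hx : ∀ i, spread (x i) ≤ s * E i) :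
    spread (fun i => x i i) ≤ (5 * s + 3) / 3 * ((E 0 + E 1 + E 2) +
      ((x 0 1 - x 1 0) ^ 2 + (x 0 2 - x 2 0) ^ 2 + (x 1 2 - x 2 1) ^ 2)) := by
  set a := (x 0 0 - x 1 1) / 3 with ha
  set b := (x 0 0 - x 2 2) / 3 with hb
  set c := (x 1 1 - x 2 2) / 3 with hc
  set T := a ^ 2 + b ^ 2 + c ^ 2 with hT
  have hsp : spread (fun i => x i i) = 9 * T := by
    simp only [spread, hT, ha, hb, hc]; ring
  have hT0 : 0 ≤ T := by positivity
  have hblock : ∀ i (k l q : ℝ), k + l + q = 0 → (k * x i 0 + l * x i 1 + q * x i 2) ^ 2 ≤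
      ((k ^ 2 + l ^ 2 + q ^ 2) * s / 3) * E i := by
    intro i k l q h
    refine (sq_linear_le_spread (x i) h).trans ?_
    calc _ ≤ (k ^ 2 + l ^ 2 + q ^ 2) / 3 * (s * E i) := by gcongr; exact hx i
      _ = _ := by ring
  have key := Finset.sum_sq_le_sum_mul_sum_of_sq_le_mul (Finset.univ : Finset (Fin 6))
    (r := ![(a + b) * x 0 0 + (-a) * x 0 1 + (-b) * x 0 2,
      a * x 1 0 + (c - a) * x 1 1 + (-c) * x 1 2,
      b * x 2 0 + c * x 2 1 + (-b - c) * x 2 2,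
      a * (x 0 1 - x 1 0), b * (x 0 2 - x 2 0), c * (x 1 2 - x 2 1)])
    (f := ![((a + b) ^ 2 + (-a) ^ 2 + (-b) ^ 2) * s / 3,
      (a ^ 2 + (c - a) ^ 2 + (-c) ^ 2) * s / 3,
      (b ^ 2 + c ^ 2 + (-b - c) ^ 2) * s / 3, a ^ 2, b ^ 2, c ^ 2])
    (g := ![E 0, E 1, E 2, (x 0 1 - x 1 0) ^ 2, (x 0 2 - x 2 0) ^ 2, (x 1 2 - x 2 1) ^ 2])
    (by intro k _; fin_cases k <;> simp <;> positivity)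
    (by intro k _; fin_cases k <;> simp [hE] <;> positivity)
    (by
      intro k _
      fin_cases k
      · exact hblock 0 _ _ _ (by ring)
      · exact hblock 1 _ _ _ (by ring)
      · exact hblock 2 _ _ _ (by ring)
      · exact (mul_pow _ _ _).le
      · exact (mul_pow _ _ _).le
      · exact (mul_pow _ _ _).le)
  simp only [Fin.sum_univ_six, Matrix.cons_val] at key
  set S := (E 0 + E 1 + E 2) +
      ((x 0 1 - x 1 0) ^ 2 + (x 0 2 - x 2 0) ^ 2 + (x 1 2 - x 2 1) ^ 2) with hS
  have key' : (3 * T) ^ 2 ≤ (5 * s + 3) / 3 * T * S := by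
    have h1 : (3 * T) = (a + b) * x 0 0 + (c - a) * x 1 1 + (-b - c) * x 2 2 := by
      simp only [hT, ha, hb, hc]; ring
    refine (le_of_eq ?_).trans (key.trans (le_of_eq ?_))
    · rw [h1]; ring
    · have h2 : b = a + c := by simp only [ha, hb, hc]; ring
      rw [hS, hT, h2]; ring
  have hS0 : 0 ≤ S := by have := hE 0; have := hE 1; have := hE 2; positivity
  rw [hsp]
  rcases hT0.eq_or_lt with h | h
  · rw [← h, mul_zero]; positivity
  · refine le_of_mul_le_mul_right ?_ h
    calc _ = (3 * T) ^ 2 := by ring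
      _ ≤ _ := key'
      _ = _ := by ring

lemma one_le_pow_five_thirds (m : ℕ) : (1 : ℝ) ≤ (5 / 3) ^ m := one_le_pow₀ (by norm_num)

lemma IsSG.spread_corner_le (hK : IsSG K) (u : (Fin m → Fin 3) → ℝ) :
    spread (fun i => u fun _ => i) ≤ (3 / 2) * ((5 / 3) ^ m - 1) * En K u := by
  induction m with
  | zero =>
    have h : ∀ i j : Fin 3, u (fun _ => i) = u (fun _ => j) := fun i j =>
      congrArg u (Subsingleton.elim _ _)
    simp [spread, h 0 1, h 1 2]
  | succ m ih =>
    have hm := one_le_pow_five_thirds m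
    have hc : ∀ i : Fin 3, (Fin.cons i fun _ => i : Fin (m + 1) → Fin 3) = fun _ => i :=
      fun i => funext fun k => by cases k using Fin.cases <;> rfl
    have h := spread_diag_le (fun i j => u (Fin.cons i fun _ => j))
      (fun i => En K fun v => u (Fin.cons i v)) (s := (3 / 2) * ((5 / 3) ^ m - 1))
      (by linarith) (fun i => En_nonneg _ _) (fun i => ih fun v => u (Fin.cons i v))
    simp only [hc] at h
    refine h.trans ?_
    have hs : (5 * ((3 / 2) * ((5 / 3 : ℝ) ^ m - 1)) + 3) / 3 =
        (3 / 2) * ((5 / 3) ^ (m + 1) - 1) := by ring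
    rw [hs]
    refine mul_le_mul_of_nonneg_left (hK.energy_cons u) ?_
    linarith [one_le_pow_five_thirds (m + 1)]

lemma sq_sub_le_spread (x : Fin 3 → ℝ) (i j : Fin 3) : (x i - x j) ^ 2 ≤ 2 / 3 * spread x := by
  unfold spread
  fin_cases i <;> fin_cases j <;> simp only [Fin.zero_eta, Fin.mk_one, Fin.reduceFinMk] <;>
    nlinarith [sq_nonneg (x 0 - 2 * x 1 + x 2), sq_nonneg (x 0 + x 1 - 2 * x 2),
      sq_nonneg (2 * x 0 - x 1 - x 2), sq_nonneg (x 0 - x 1), sq_nonneg (x 0 - x 2),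
      sq_nonneg (x 1 - x 2)]

lemma IsSG.sq_corner_sub_corner_le (hK : IsSG K) (u : (Fin m → Fin 3) → ℝ) (i j : Fin 3) :
    (u (fun _ => i) - u (fun _ => j)) ^ 2 ≤ ((5 / 3) ^ m - 1) * En K u := by
  linarith [hK.spread_corner_le u, sq_sub_le_spread (fun k => u fun _ => k) i j]

lemma sq_add_three_le {a b c A B C α β : ℝ} (hA : 0 ≤ A) (hB : 0 ≤ B) (hC : 0 ≤ C) (hα : 0 ≤ α)
    (hβ : 0 ≤ β) (ha : a ^ 2 ≤ α * A) (hb : b ^ 2 ≤ B) (hc : c ^ 2 ≤ β * C) :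
    (a + b + c) ^ 2 ≤ (α + 1 + β) * (A + B + C) := by
  have key := Finset.sum_sq_le_sum_mul_sum_of_sq_le_mul (Finset.univ : Finset (Fin 3))
    (r := ![a, b, c]) (f := ![α, 1, β]) (g := ![A, B, C])
    (by intro k _; fin_cases k <;> simp [hα, hβ])
    (by intro k _; fin_cases k <;> simp [hA, hB, hC])
    (by intro k _; fin_cases k <;> simp [ha, hb, hc])
  simpa only [Fin.sum_univ_three, Matrix.cons_val] using key

lemma IsSG.sq_sub_corner_le (hK : IsSG K) (u : (Fin m → Fin 3) → ℝ) (x : Fin m → Fin 3)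
    (j : Fin 3) :
    (u x - u (fun _ => j)) ^ 2 ≤ (3 / 2) * ((5 / 3) ^ m - 1) * En K u := by
  induction m generalizing j with
  | zero =>
    rw [Subsingleton.elim x fun _ => j]
    simp
  | succ m ih =>
    have hm := one_le_pow_five_thirds m
    have hc : (fun _ => j : Fin (m + 1) → Fin 3) = Fin.cons j fun _ => j :=
      funext fun k => by cases k using Fin.cases <;> rfl
    obtain ⟨i, y, rfl⟩ : ∃ i y, x = Fin.cons i y := ⟨x 0, Fin.tail x, by simp⟩
    rw [hc]
    have ihi := ih (fun v => u (Fin.cons i v)) y j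
    by_cases hij : i = j
    · subst hij
      refine ihi.trans ?_
      have := En_nonneg K u
      have := hK.energy_cons_le u i
      rw [pow_succ]
      calc _ ≤ (3 / 2) * ((5 / 3) ^ m - 1) * En K u :=
            mul_le_mul_of_nonneg_left this (by linarith)
        _ ≤ _ := mul_le_mul_of_nonneg_right (by linarith) (by assumption)
    · have h := sq_add_three_le (En_nonneg K _)
        (sq_nonneg (u (Fin.cons i fun _ => j) - u (Fin.cons j fun _ => i))) (En_nonneg K _)
        (by linarith) (by linarith) ihi le_rfl
        (hK.sq_corner_sub_corner_le (fun v => u (Fin.cons j v)) i j)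
      have h' := hK.energy_cons_pair_le u hij
      calc _ = _ := by ring
        _ ≤ _ := h
        _ ≤ _ := mul_le_mul_of_nonneg_left h' (by linarith)
        _ = _ := by ring

lemma IsSG.sq_mean_sub_corner_le (hK : IsSG K) (u : (Fin m → Fin 3) → ℝ) (j : Fin 3) :
    ((1 / 3) ^ m * ∑ v, u v - u (fun _ => j)) ^ 2 ≤ (3 / 2) * (5 / 3) ^ m * En K u := by
  have hcard : ((Finset.univ : Finset (Fin m → Fin 3)).card : ℝ) = 3 ^ m := by simp
  have h3 : (0 : ℝ) < 3 ^ m := by positivity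
  have h13 : ((1 : ℝ) / 3) ^ m * 3 ^ m = 1 := by rw [← mul_pow]; norm_num
  have hJ := sq_sum_le_card_mul_sum_sq (s := (Finset.univ : Finset (Fin m → Fin 3)))
    (f := fun v => u v - u fun _ => j)
  have hS : ∑ v : Fin m → Fin 3, (u v - u fun _ => j) ^ 2 ≤
      3 ^ m * ((3 / 2) * ((5 / 3) ^ m - 1) * En K u) := by
    rw [← hcard, ← nsmul_eq_mul]
    exact Finset.sum_le_card_nsmul _ _ _ fun v _ => hK.sq_sub_corner_le u v j
  rw [hcard] at hJ
  have hmean : (1 / 3) ^ m * ∑ v, u v - u (fun _ => j) =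
      (1 / 3) ^ m * ∑ v : Fin m → Fin 3, (u v - u fun _ => j) := by
    rw [Finset.sum_sub_distrib, Finset.sum_const, nsmul_eq_mul, hcard, mul_sub, ← mul_assoc,
      h13, one_mul]
  rw [hmean, mul_pow]
  have hE := En_nonneg K u
  calc _ ≤ ((1 / 3 : ℝ) ^ m) ^ 2 * (3 ^ m * (3 ^ m * ((3 / 2) * ((5 / 3) ^ m - 1) * En K u))) := by
        gcongr
        exact hJ.trans (by gcongr)
    _ = ((1 / 3 : ℝ) ^ m * 3 ^ m) ^ 2 * ((3 / 2) * ((5 / 3) ^ m - 1) * En K u) := by ring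
    _ ≤ _ := by
        rw [h13]
        nlinarith

end Estimates

lemma IsSG.En_Mop_le {K : Set ℂ} (hK : IsSG K) (n m : ℕ) (u : (Fin (n + m) → Fin 3) → ℝ) :
    En K (Mop n m u) ≤ 36 * (5 / 3) ^ m * En K u := by
  choose! c c' hc using fun (w w' : Fin n → Fin 3) (h : Adj K w w') => hK.exists_corners h
  set B : (Fin n → Fin 3) → ℝ := fun w => En K fun v : Fin m → Fin 3 => u (Fin.append w v) with hB
  set D : (Fin n → Fin 3) → (Fin n → Fin 3) → ℝ := fun w w' =>
    if Adj K w w' then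
      (u (Fin.append w fun _ => c w w') - u (Fin.append w' fun _ => c' w w')) ^ 2 else 0 with hD
  have hB0 : ∀ w, 0 ≤ B w := fun w => En_nonneg _ _
  have hD0 : ∀ w w', 0 ≤ D w w' := fun w w' => by
    simp only [hD]
    split_ifs <;> positivity
  have hm := one_le_pow_five_thirds m
  set q : ℝ := (5 / 3) ^ m with hq
  have hsplit : ∑ w, B w + (1 / 2) * ∑ w, ∑ w', D w w' ≤ En K u :=
    energy_split (Fin.appendEquiv n m) (R := Adj K) (r := Adj K) (s := Adj K)
      (fun w w' _ => c w w') (fun w w' _ => c' w w') (fun _ _ h => h.1)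
      (fun w _ _ h => adj_append w h) (fun w w' h => hK.adj_append_corner h.1 (hc w w' h)) u
  have hterm : ∀ w w', (if Adj K w w' then (Mop n m u w - Mop n m u w') ^ 2 else 0) ≤
      (9 / 2) * q * (if Adj K w w' then B w else 0) +
        (9 / 2) * q * (if Adj K w w' then B w' else 0) + 3 * D w w' := by
    intro w w'
    by_cases h : Adj K w w'
    · have h1 := hK.sq_mean_sub_corner_le (fun v => u (Fin.append w v)) (c w w')
      have h2 := hK.sq_mean_sub_corner_le (fun v => u (Fin.append w' v)) (c' w w')
      simp only [hD, if_pos h, Mop]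
      set M := (1 / 3) ^ m * ∑ v, u (Fin.append w v)
      set M' := (1 / 3) ^ m * ∑ v, u (Fin.append w' v)
      set y := u (Fin.append w fun _ => c w w')
      set y' := u (Fin.append w' fun _ => c' w w')
      change _ ≤ 3 / 2 * q * B w at h1
      change _ ≤ 3 / 2 * q * B w' at h2
      nlinarith [sq_nonneg ((M - y) - (y - y')), sq_nonneg ((M - y) + (M' - y')),
        sq_nonneg ((y - y') + (M' - y'))]
    · simp [h, hD]
  have hdeg : ∀ w, ∑ w', (if Adj K w w' then B w else 0) ≤ 6 * B w := by
    intro w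
    rw [← Finset.sum_filter, Finset.sum_const, nsmul_eq_mul]
    refine mul_le_mul_of_nonneg_right ?_ (hB0 w)
    exact_mod_cast card_adj_le hK w
  have hsymm : ∀ w w' : Fin n → Fin 3, Adj K w w' ↔ Adj K w' w := fun w w' => by
    rw [Adj, Adj, ne_comm, Set.inter_comm]
  have hsum1 : ∑ w, ∑ w', (if Adj K w w' then B w else 0) ≤ 6 * ∑ w, B w := by
    rw [Finset.mul_sum]
    exact Finset.sum_le_sum fun w _ => hdeg w
  have hsum2 : ∑ w, ∑ w', (if Adj K w w' then B w' else 0) ≤ 6 * ∑ w, B w := by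
    rw [Finset.sum_comm]
    refine le_trans (le_of_eq ?_) hsum1
    exact Finset.sum_congr rfl fun w _ => Finset.sum_congr rfl fun w' _ => by
      simp only [hsymm w w']
  have hsum := Finset.sum_le_sum fun w (_ : w ∈ Finset.univ) =>
    Finset.sum_le_sum fun w' (_ : w' ∈ Finset.univ) => hterm w w'
  simp only [Finset.sum_add_distrib, ← Finset.mul_sum] at hsum
  have hBs : 0 ≤ ∑ w, B w := Finset.sum_nonneg fun w _ => hB0 w
  have hDs : 0 ≤ ∑ w, ∑ w', D w w' :=
    Finset.sum_nonneg fun w _ => Finset.sum_nonneg fun w' _ => hD0 w w'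
  have hq0 : 0 ≤ 9 / 2 * q := by linarith
  have e1 := mul_le_mul_of_nonneg_left hsum1 hq0
  have e2 := mul_le_mul_of_nonneg_left hsum2 hq0
  have e3 := mul_le_mul_of_nonneg_left hsplit (by linarith : 0 ≤ 36 * q)
  have e4 := mul_nonneg (by linarith : 0 ≤ q) hBs
  have e5 := mul_le_mul_of_nonneg_right hm hDs
  unfold En at e3 ⊢
  linarith

theorem statement10 (K : Set ℂ) (hK : IsSG K) (n m : ℕ) (hn : 1 ≤ n) (hm : 1 ≤ m)
    (u : (Fin (n + m) → Fin 3) → ℝ) :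
    G K (Mop n m u) ≤ 36 * G K u ∧
    En K (Mop n m u) ≤ 36 * (5/3)^m * En K u := by
  have h := hK.En_Mop_le n m u
  refine ⟨?_, h⟩
  calc G K (Mop n m u) ≤ (5 / 3) ^ n * (36 * (5 / 3) ^ m * En K u) :=
        mul_le_mul_of_nonneg_left h (by positivity)
    _ = 36 * G K u := by rw [G, pow_add]; ring

end SG
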